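/- arXiv:1708.04153 — 4 statements merged into one kernel-verified Lean document; each statement's English description precedes it below -/
import Mathlib

section
/- Let R be a commutative local ring with maximal ideal m and residue field k = R/m, let M be a finite free R-module, and let B : M × M → R be a symmetric bilinear form. If the bilinear form induced by B on the k-vector space M ⊗_R k is nondegenerate, then the R-linear map M → Hom_R(M, R) sending x to B(x, −) is bijective. -/
/-- A bilinear form on a finite module whose Gram matrix in some basis has unit determinant induces
a bijection onto the dual module. -/
theorem LinearMap.BilinForm.bijective_of_isUnit_det_toMatrix {R M ι : Type*} [CommRing R]
    [AddCommGroup M] [Module R M] [Fintype ι] [DecidableEq ι] (b : Module.Basis ι R M)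
    (B : LinearMap.BilinForm R M) (h : IsUnit (BilinForm.toMatrix b B).det) :
    Function.Bijective (fun x : M => (B x : M →ₗ[R] R)) := by
  have hB : LinearMap.toMatrix b b.dualBasis B = (BilinForm.toMatrix b B).transpose := by
    ext i j
    simp [LinearMap.toMatrix_apply, BilinForm.toMatrix_apply]
  rw [← Matrix.det_transpose, ← hB] at h
  exact (LinearEquiv.ofIsUnitDet h).bijective

/-- The Gram matrix of a base-changed bilinear form is the image of the original Gram matrix. -/
theorem LinearMap.BilinForm.toMatrix_baseChange {R M ι : Type*} (A : Type*) [CommRing R]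
    [CommRing A] [Algebra R A] [AddCommGroup M] [Module R M] [Fintype ι] [DecidableEq ι]
    (b : Module.Basis ι R M) (B : LinearMap.BilinForm R M) :
    BilinForm.toMatrix (b.baseChange A) (B.baseChange A) =
      (algebraMap R A).mapMatrix (BilinForm.toMatrix b B) := by
  ext i j
  simp [BilinForm.toMatrix_apply, Algebra.algebraMap_eq_smul_one]

/-- Over a commutative local ring `R` with residue field `k`, a symmetric
bilinear form `B` on a finite free `R`-module `M` whose reduction to `M ⊗ k` is
nondegenerate induces a bijection `M → Hom_R(M, R)`, `x ↦ B(x, −)`. -/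
theorem stmt_2 {R : Type*} [CommRing R] [IsLocalRing R]
    (M : Type*) [AddCommGroup M] [Module R M] [Module.Free R M] [Module.Finite R M]
    (B : LinearMap.BilinForm R M) (hsymm : ∀ x y, B x y = B y x)
    (hnd : (B.baseChange (IsLocalRing.ResidueField R)).Nondegenerate) :
    Function.Bijective (fun x : M => (B x : M →ₗ[R] R)) := by
  classical
  let b := Module.Free.chooseBasis R M
  apply B.bijective_of_isUnit_det_toMatrix b
  rw [LinearMap.BilinForm.nondegenerate_iff_det_ne_zero
    (b.baseChange (IsLocalRing.ResidueField R)), LinearMap.BilinForm.toMatrix_baseChange,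
    ← RingHom.map_det] at hnd
  exact (IsLocalRing.residue_ne_zero_iff_isUnit _).mp hnd
end

section
/- Let R be a commutative ring and n a natural number. Suppose Matrix n n R = L ⊕ C is an internal direct sum of R-submodules, with projection π onto L along C, and suppose that for every X ∈ L both summands are stable under the commutator with X: if Z ∈ L then X*Z − Z*X ∈ L, and if Z ∈ C then X*Z − Z*X ∈ C. Then for every X ∈ L and every natural number i, the matrix π(X^i) commutes with X, i.e. X * π(X^i) = π(X^i) * X. -/
/-- If `Matrix n n R = L ⊕ C` is an internal direct sum of `R`-submodules,
with projection `π` onto `L` along `C` (identity on `L`, zero on `C`), such that for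
every `X ∈ L` both `L` and `C` are stable under the commutator with `X`, then for every
`X ∈ L` and every natural number `i`, the matrix `π(X^i)` commutes with `X`. -/
theorem stmt_5 {R : Type*} [CommRing R] (n : ℕ)
    (L C : Submodule R (Matrix (Fin n) (Fin n) R)) (hcompl : IsCompl L C)
    (π : Matrix (Fin n) (Fin n) R →ₗ[R] Matrix (Fin n) (Fin n) R)
    (hπL : ∀ X ∈ L, π X = X) (hπC : ∀ X ∈ C, π X = 0)
    (hstabL : ∀ X ∈ L, ∀ Z ∈ L, X * Z - Z * X ∈ L)
    (hstabC : ∀ X ∈ L, ∀ Z ∈ C, X * Z - Z * X ∈ C) :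
    ∀ X ∈ L, ∀ i : ℕ, X * π (X ^ i) = π (X ^ i) * X := by
  intro X hX i
  obtain ⟨a, ha, c, hc, hac⟩ : ∃ a ∈ L, ∃ c ∈ C, a + c = X ^ i :=
    Submodule.mem_sup.mp (hcompl.sup_eq_top ▸ Submodule.mem_top)
  have hπ : π (X ^ i) = a := by rw [← hac, map_add, hπL a ha, hπC c hc, add_zero]
  have hsum : (X * a - a * X) + (X * c - c * X) = 0 := by
    have hcomm : X * (a + c) = (a + c) * X := by rw [hac, ← pow_succ', pow_succ]
    rw [← sub_eq_zero.mpr hcomm]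
    noncomm_ring
  have hzero := congrArg π hsum
  rw [map_add, hπL _ (hstabL X hX a ha), hπC _ (hstabC X hX c hc), add_zero, map_zero] at hzero
  rw [hπ]
  exact sub_eq_zero.mp hzero
end

section
/- Let k be an algebraically closed field of characteristic 2, and let M be the 3×3 matrix [[x₁, 0, x₂], [x₃, 1, x₄], [x₅, 0, x₆]] over k. Then the three equations x₁x₅ + x₃² = 0, x₂x₆ + x₄² = 0, and x₁x₆ + x₂x₅ + 1 = 0 hold if and only if there exists a 2×2 matrix g = [[a,b],[c,d]] over k with det g = 1 such that M = [[a², 0, b²], [ac, 1, bd], [c², 0, d²]]. -/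
/-- Over an algebraically closed field `k` of characteristic `2`, a matrix
`M = [[x₁,0,x₂],[x₃,1,x₄],[x₅,0,x₆]]` satisfies `x₁x₅ + x₃² = 0`, `x₂x₆ + x₄² = 0` and
`x₁x₆ + x₂x₅ + 1 = 0` if and only if it is of the form
`[[a²,0,b²],[ac,1,bd],[c²,0,d²]]` for some `g = [[a,b],[c,d]]` with `det g = 1`. -/
theorem stmt_10 {k : Type*} [Field k] [IsAlgClosed k] [CharP k 2]
    (x₁ x₂ x₃ x₄ x₅ x₆ : k) :
    (x₁ * x₅ + x₃ ^ 2 = 0 ∧ x₂ * x₆ + x₄ ^ 2 = 0 ∧ x₁ * x₆ + x₂ * x₅ + 1 = 0) ↔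
      ∃ a b c d : k, a * d - b * c = 1 ∧
        !![x₁, 0, x₂; x₃, 1, x₄; x₅, 0, x₆] =
          !![a ^ 2, 0, b ^ 2; a * c, 1, b * d; c ^ 2, 0, d ^ 2] := by
  have h_two : (2 : k) = 0 := CharTwo.two_eq_zero
  constructor
  · rintro ⟨h₁₅, h₂₆, h_det⟩
    obtain ⟨a, rfl⟩ := IsAlgClosed.exists_pow_nat_eq x₁ two_pos
    obtain ⟨b, rfl⟩ := IsAlgClosed.exists_pow_nat_eq x₂ two_pos
    obtain ⟨c, rfl⟩ := IsAlgClosed.exists_pow_nat_eq x₅ two_pos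
    obtain ⟨d, rfl⟩ := IsAlgClosed.exists_pow_nat_eq x₆ two_pos
    have h_ac : x₃ = a * c := CharTwo.sq_inj.mp (by
      linear_combination h₁₅ - a ^ 2 * c ^ 2 * h_two)
    have h_bd : x₄ = b * d := CharTwo.sq_inj.mp (by
      linear_combination h₂₆ - b ^ 2 * d ^ 2 * h_two)
    refine ⟨a, b, c, d, CharTwo.sq_inj.mp ?_, by rw [h_ac, h_bd]⟩
    linear_combination h_det - (a * d * b * c + 1) * h_two
  · rintro ⟨a, b, c, d, h_det, h⟩
    have entry (i j : Fin 3) := congrFun (congrFun h i) j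
    obtain rfl : x₁ = a ^ 2 := by simpa using entry 0 0
    obtain rfl : x₂ = b ^ 2 := by simpa using entry 0 2
    obtain rfl : x₃ = a * c := by simpa using entry 1 0
    obtain rfl : x₄ = b * d := by simpa using entry 1 2
    obtain rfl : x₅ = c ^ 2 := by simpa using entry 2 0
    obtain rfl : x₆ = d ^ 2 := by simpa using entry 2 2
    refine ⟨?_, ?_, ?_⟩
    · linear_combination a ^ 2 * c ^ 2 * h_two
    · linear_combination b ^ 2 * d ^ 2 * h_two
    · linear_combination (a * d - b * c + 1) * h_det + (a * d * b * c + 1) * h_two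
end

section
/- Let k be a field of characteristic 2 and let M = [[x₁, 0, x₂], [x₃, 1, x₄], [x₅, 0, x₆]] be a 3×3 matrix over k satisfying x₁x₅ + x₃² = 0, x₂x₆ + x₄² = 0, and x₁x₆ + x₂x₅ + 1 = 0. Then M is unipotent (i.e. (M − 1)³ = 0, equivalently M − 1 is nilpotent) if and only if x₆ = x₁. -/
/-- Over a field of characteristic `2`, a matrix
`M = [[x₁,0,x₂],[x₃,1,x₄],[x₅,0,x₆]]` satisfying `x₁x₅ + x₃² = 0`, `x₂x₆ + x₄² = 0` and
`x₁x₆ + x₂x₅ + 1 = 0` is unipotent (i.e. `(M − 1)³ = 0`, equivalently `M − 1` nilpotent)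
if and only if `x₆ = x₁`. -/
theorem stmt_12 {k : Type*} [Field k] [CharP k 2] (x₁ x₂ x₃ x₄ x₅ x₆ : k)
    (h₁ : x₁ * x₅ + x₃ ^ 2 = 0) (h₂ : x₂ * x₆ + x₄ ^ 2 = 0)
    (h₃ : x₁ * x₆ + x₂ * x₅ + 1 = 0) :
    ((!![x₁, 0, x₂; x₃, 1, x₄; x₅, 0, x₆] - 1) ^ 3 = 0 ↔ x₆ = x₁) ∧
      (IsNilpotent (!![x₁, 0, x₂; x₃, 1, x₄; x₅, 0, x₆] - 1) ↔ x₆ = x₁) := by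
  have two_eq_zero : (2 : k) = 0 := CharTwo.two_eq_zero
  have eq_of_nilpotent :
      IsNilpotent (!![x₁, 0, x₂; x₃, 1, x₄; x₅, 0, x₆] - 1) → x₆ = x₁ := fun h => by
    have htrace := (Matrix.isNilpotent_trace_of_isNilpotent h).eq_zero
    simp only [Matrix.trace_sub, Matrix.trace_fin_three_of, Matrix.trace_one, Fintype.card_fin,
      Nat.cast_ofNat] at htrace
    linear_combination htrace + (1 - x₁) * two_eq_zero
  have cube_eq_zero :
      x₆ = x₁ → (!![x₁, 0, x₂; x₃, 1, x₄; x₅, 0, x₆] - 1) ^ 3 = 0 := by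
    rintro rfl
    have hdet : (x₆ - 1) * (x₆ - 1) + x₂ * x₅ = 0 := by
      linear_combination h₃ - x₆ * two_eq_zero
    rw [Matrix.one_fin_three, pow_three]
    ext i j
    fin_cases i <;> fin_cases j <;> simp [Matrix.mul_apply, Fin.sum_univ_three]
    · linear_combination (x₆ - 1) * hdet + (x₆ - 1) * x₂ * x₅ * two_eq_zero
    · linear_combination x₂ * hdet + (x₆ - 1) ^ 2 * x₂ * two_eq_zero
    · linear_combination x₃ * hdet + (x₆ - 1) * x₄ * x₅ * two_eq_zero
    · linear_combination x₄ * hdet + (x₆ - 1) * x₂ * x₃ * two_eq_zero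
    · linear_combination x₅ * hdet + (x₆ - 1) ^ 2 * x₅ * two_eq_zero
    · linear_combination (x₆ - 1) * hdet + (x₆ - 1) * x₂ * x₅ * two_eq_zero
  exact ⟨⟨fun h => eq_of_nilpotent ⟨3, h⟩, cube_eq_zero⟩,
    eq_of_nilpotent, fun h => ⟨3, cube_eq_zero h⟩⟩
end
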